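/- Let R be a short linear order equipped with a σ-algebra containing all initial segments (-∞, r], and let P be a probability measure on R. Then every singleton {r} is measurable, and P is atomless if and only if P{r} = 0 for every r ∈ R (i.e., if and only if no singleton is an atom). -/

import Mathlib

open MeasureTheory

/-- The set of countable ordinals (the first uncountable ordinal ω₁), with its natural order. -/
abbrev Omega1 : Type 1 := {o : Ordinal // o.card ≤ Cardinal.aleph0}

/-- An atom of a measure: a measurable set of positive measure that cannot be split into
two disjoint measurable sets of positive measure. -/
def IsMeasureAtom {α : Type*} [MeasurableSpace α] (P : Measure α) (A : Set α) : Prop :=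
  MeasurableSet A ∧ 0 < P A ∧
    ¬ ∃ B C : Set α, MeasurableSet B ∧ MeasurableSet C ∧ Disjoint B C ∧ B ∪ C = A ∧
      0 < P B ∧ 0 < P C

/-- If every countable subset of `S` has a strict upper bound in `S`, then every well-order with
countable initial segments embeds into the ambient order. -/
theorem nonempty_orderEmbedding_of_countable_bounded {ι R : Type*} [LinearOrder ι]
    [WellFoundedLT ι] [LinearOrder R] (hι : ∀ i : ι, (Set.Iio i).Countable) (S : Set R)
    (hS : ∀ T ⊆ S, T.Countable → ∃ s ∈ S, ∀ t ∈ T, t < s) : Nonempty (ι ↪o R) := by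
  have : Nonempty R := let ⟨s, _⟩ := hS ∅ (Set.empty_subset S) Set.countable_empty; ⟨s⟩
  choose! g hgS hg using hS
  let f : ι → R := (wellFounded_lt (α := ι)).fix
    (fun i ih => g {x | ∃ (j : ι) (h : j < i), ih j h = x})
  have hf (i : ι) : f i = g (f '' Set.Iio i) := by
    have h := (wellFounded_lt (α := ι)).fix_eq
      (fun i ih => g {x : R | ∃ (j : ι) (h : j < i), ih j h = x}) i
    refine h.trans (congrArg g ?_)
    ext x
    simp [f]
  have hmem (i : ι) : f i ∈ S := by
    induction i using WellFoundedLT.induction with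
    | ind i ih =>
      rw [hf]
      exact hgS _ (by rintro _ ⟨j, hj, rfl⟩; exact ih j hj) ((hι i).image f)
  have hmono : StrictMono f := fun j i hji => by
    rw [hf i]
    exact hg _ (by rintro _ ⟨k, -, rfl⟩; exact hmem k) ((hι i).image f) _ ⟨j, hji, rfl⟩
  exact ⟨OrderEmbedding.ofStrictMono f hmono⟩

theorem Omega1.countable_Iio (i : Omega1) : (Set.Iio i).Countable := by
  have h : (Set.Iio i.1).Countable := by
    rw [← Cardinal.le_aleph0_iff_set_countable, Cardinal.mk_Iio_ordinal, Cardinal.lift_le_aleph0]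
    exact i.2
  exact h.preimage Subtype.val_injective

theorem exists_countable_cofinal_subset {R : Type*} [LinearOrder R]
    (hR : ¬ Nonempty (Omega1 ↪o R)) (S : Set R) :
    ∃ T ⊆ S, T.Countable ∧ ∀ s ∈ S, ∃ t ∈ T, s ≤ t := by
  by_contra! h
  exact hR (nonempty_orderEmbedding_of_countable_bounded Omega1.countable_Iio S h)

theorem exists_countable_coinitial_subset {R : Type*} [LinearOrder R]
    (hR : ¬ Nonempty (Omega1ᵒᵈ ↪o R)) (S : Set R) :
    ∃ T ⊆ S, T.Countable ∧ ∀ s ∈ S, ∃ t ∈ T, t ≤ s :=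
  exists_countable_cofinal_subset (R := Rᵒᵈ) (fun ⟨e⟩ => hR ⟨e.dual⟩) S

theorem measurableSet_singleton_of_measurableSet_Iic {R : Type*} [LinearOrder R]
    [MeasurableSpace R] (hR : ¬ Nonempty (Omega1 ↪o R))
    (hIic : ∀ r : R, MeasurableSet (Set.Iic r)) (r : R) : MeasurableSet ({r} : Set R) := by
  obtain ⟨T, hTS, hT, hcof⟩ := exists_countable_cofinal_subset hR (Set.Iio r)
  have hIio : Set.Iio r = ⋃ t ∈ T, Set.Iic t := by
    ext x
    simp only [Set.mem_iUnion, Set.mem_Iic, exists_prop]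
    exact ⟨hcof x, fun ⟨t, ht, hxt⟩ => hxt.trans_lt (hTS ht)⟩
  have h : MeasurableSet (Set.Iio r) := hIio ▸ MeasurableSet.biUnion hT fun t _ => hIic t
  rw [← Set.Iic_sdiff_Iio_same]
  exact (hIic r).diff h

theorem IsMeasureAtom.measure_inter_eq_zero_or {α : Type*} [MeasurableSpace α] {P : Measure α}
    {A B : Set α} (hA : IsMeasureAtom P A) (hB : MeasurableSet B) :
    P (A ∩ B) = 0 ∨ P (A \ B) = 0 := by
  by_contra! h
  exact hA.2.2 ⟨A ∩ B, A \ B, hA.1.inter hB, hA.1.diff hB, Set.disjoint_sdiff_inter.symm,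
    Set.inter_union_sdiff A B, pos_iff_ne_zero.2 h.1, pos_iff_ne_zero.2 h.2⟩

theorem isMeasureAtom_singleton {α : Type*} [MeasurableSpace α] {P : Measure α} {a : α}
    (ha : MeasurableSet ({a} : Set α)) (h : P {a} ≠ 0) : IsMeasureAtom P {a} := by
  refine ⟨ha, pos_iff_ne_zero.2 h, ?_⟩
  rintro ⟨B, C, -, -, hd, hu, hB, hC⟩
  obtain ⟨b, hb⟩ := nonempty_of_measure_ne_zero hB.ne'
  obtain ⟨c, hc⟩ := nonempty_of_measure_ne_zero hC.ne'
  have hba : b = a := hu.subset (Or.inl hb)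
  have hca : c = a := hu.subset (Or.inr hc)
  subst hba hca
  exact Set.disjoint_left.1 hd hb hc

theorem not_isMeasureAtom_of_measure_singleton_eq_zero {R : Type*} [LinearOrder R]
    [MeasurableSpace R] (hshort₁ : ¬ Nonempty (Omega1 ↪o R))
    (hshort₂ : ¬ Nonempty (Omega1ᵒᵈ ↪o R)) (hIic : ∀ r : R, MeasurableSet (Set.Iic r))
    {P : Measure R} (hP : ∀ r : R, P {r} = 0) (A : Set R) : ¬ IsMeasureAtom P A := by
  intro hA
  obtain ⟨T, hTS, hT, hcof⟩ :=
    exists_countable_cofinal_subset hshort₁ {r | P (A ∩ Set.Iic r) = 0}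
  obtain ⟨U, hUS, hU, hcoi⟩ :=
    exists_countable_coinitial_subset hshort₂ {r | P (A \ Set.Iic r) = 0}
  have hcover : A ⊆ (⋃ t ∈ T, A ∩ Set.Iic t) ∪ ⋃ u ∈ U, (A \ Set.Iic u ∪ {u}) := by
    intro x hx
    rcases hA.measure_inter_eq_zero_or (hIic x) with h | h
    · obtain ⟨t, ht, hxt⟩ := hcof x h
      exact Or.inl (Set.mem_biUnion ht ⟨hx, hxt⟩)
    · obtain ⟨u, hu, hux⟩ := hcoi x h
      refine Or.inr (Set.mem_biUnion hu ?_)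
      rcases hux.eq_or_lt with rfl | hlt
      · exact Or.inr rfl
      · exact Or.inl ⟨hx, not_le.2 hlt⟩
  refine hA.2.1.ne' (measure_mono_null hcover (measure_union_null ?_ ?_))
  · exact (measure_biUnion_null_iff hT).2 fun t ht => hTS ht
  · exact (measure_biUnion_null_iff hU).2 fun u hu => measure_union_null (hUS hu) (hP u)

theorem stmt13 (R : Type*) [LinearOrder R] [MeasurableSpace R]
    (hshort₁ : ¬ Nonempty (Omega1 ↪o R)) (hshort₂ : ¬ Nonempty (Omega1ᵒᵈ ↪o R))
    (hIic : ∀ r : R, MeasurableSet (Set.Iic r))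
    (P : Measure R) [IsProbabilityMeasure P] :
    (∀ r : R, MeasurableSet ({r} : Set R)) ∧
    ((¬ ∃ A : Set R, IsMeasureAtom P A) ↔ ∀ r : R, P {r} = 0) := by
  have hsing := measurableSet_singleton_of_measurableSet_Iic hshort₁ hIic
  refine ⟨hsing, fun h r => ?_, fun h => ?_⟩
  · by_contra hr
    exact h ⟨{r}, isMeasureAtom_singleton (hsing r) hr⟩
  · rintro ⟨A, hA⟩
    exact not_isMeasureAtom_of_measure_singleton_eq_zero hshort₁ hshort₂ hIic h A hA
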